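/- arXiv:2408.13046 — 3 statements merged into one kernel-verified Lean document; each statement's English description precedes it below -/
import Mathlib

section
/- Let $\bar{C}$ be an $N \times N$ real positive definite matrix, let $\xi \in \mathbb{R}^N$ be nonzero, let $d > 0$ be defined by $d^2 = \xi^\mathrm{T} \bar{C}^{-1} \xi$, let $\gamma > 0$, and set $\zeta = (d^2 - \gamma^2)/(d^2 \gamma^2)$. Then the corrected matrix $C = \bar{C} + \zeta\, \xi \xi^\mathrm{T}$ is invertible and satisfies $\xi^\mathrm{T} C^{-1} \xi = \gamma^2$; that is, the margin correction sets the squared Mahalanobis distance of $\xi$ under $C$ exactly to $\gamma^2$. -/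
open Matrix

namespace Matrix

variable {n K : Type*} [Fintype n] [DecidableEq n] [Field K]

theorem add_smul_vecMulVec_mulVec_inv_mulVec {A : Matrix n n K} (hA : IsUnit A)
    (u v : n → K) (r : K) :
    (A + r • vecMulVec u v) *ᵥ (A⁻¹ *ᵥ u) = (1 + r * (v ⬝ᵥ A⁻¹ *ᵥ u)) • u := by
  have hdet : IsUnit A.det := (isUnit_iff_isUnit_det A).1 hA
  rw [add_mulVec, mulVec_mulVec, mul_nonsing_inv A hdet, one_mulVec, smul_mulVec,
    vecMulVec_mulVec, op_smul_eq_smul, smul_smul, add_smul, one_smul]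

/-- A rank-one update of an invertible matrix is invertible if its Sherman-Morrison denominator
does not vanish. -/
theorem isUnit_add_smul_vecMulVec {A : Matrix n n K} (hA : IsUnit A) (u v : n → K) (r : K)
    (h : 1 + r * (v ⬝ᵥ A⁻¹ *ᵥ u) ≠ 0) : IsUnit (A + r • vecMulVec u v) := by
  have hdet : IsUnit A.det := (isUnit_iff_isUnit_det A).1 hA
  rw [← mulVec_injective_iff_isUnit]
  refine (injective_iff_map_eq_zero (mulVecLin (A + r • vecMulVec u v))).2 fun x hx => ?_
  rw [mulVecLin_apply, add_mulVec, smul_mulVec, vecMulVec_mulVec, op_smul_eq_smul,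
    smul_smul] at hx
  have hx' : x + (r * (v ⬝ᵥ x)) • (A⁻¹ *ᵥ u) = 0 := by
    have := congrArg (A⁻¹ *ᵥ ·) hx
    simpa only [mulVec_add, mulVec_mulVec, nonsing_inv_mul A hdet, one_mulVec, mulVec_smul,
      mulVec_zero] using this
  have hv : (v ⬝ᵥ x) * (1 + r * (v ⬝ᵥ A⁻¹ *ᵥ u)) = 0 := by
    have := congrArg (v ⬝ᵥ ·) hx'
    simp only [dotProduct_add, dotProduct_smul, smul_eq_mul, dotProduct_zero] at this
    linear_combination this
  have hvx : v ⬝ᵥ x = 0 := (mul_eq_zero.1 hv).resolve_right h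
  simpa [hvx] using hx'

/-- The Sherman-Morrison formula for the bilinear form of the inverse at the update vectors. -/
theorem dotProduct_inv_add_smul_vecMulVec_mulVec {A : Matrix n n K} (hA : IsUnit A)
    (u v : n → K) (r : K) (h : 1 + r * (v ⬝ᵥ A⁻¹ *ᵥ u) ≠ 0) :
    v ⬝ᵥ (A + r • vecMulVec u v)⁻¹ *ᵥ u =
      (v ⬝ᵥ A⁻¹ *ᵥ u) / (1 + r * (v ⬝ᵥ A⁻¹ *ᵥ u)) := by
  have hdet := (isUnit_iff_isUnit_det _).1 (isUnit_add_smul_vecMulVec hA u v r h)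
  have key := congrArg ((A + r • vecMulVec u v)⁻¹ *ᵥ ·)
    (add_smul_vecMulVec_mulVec_inv_mulVec hA u v r)
  simp only [mulVec_mulVec _ (A + r • vecMulVec u v)⁻¹, nonsing_inv_mul _ hdet, one_mulVec,
    mulVec_smul] at key
  rw [eq_div_iff h]
  have := congrArg (v ⬝ᵥ ·) key
  simp only [dotProduct_smul, smul_eq_mul] at this
  linear_combination -this

end Matrix

/-- The margin correction `C = C̄ + ζ ξ ξᵀ` with `ζ = (d² - γ²)/(d² γ²)`, where
`d² = ξᵀ C̄⁻¹ ξ`, yields an invertible matrix `C` with `ξᵀ C⁻¹ ξ = γ²`. -/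
theorem margin_correction_sets_mahalanobis {N : ℕ}
    (Cbar : Matrix (Fin N) (Fin N) ℝ) (hCbar : Cbar.PosDef)
    (ξ : Fin N → ℝ) (hξ : ξ ≠ 0)
    (d γ : ℝ) (hd : 0 < d) (hγ : 0 < γ)
    (hd2 : d ^ 2 = ξ ⬝ᵥ Cbar⁻¹ *ᵥ ξ)
    (ζ : ℝ) (hζ : ζ = (d ^ 2 - γ ^ 2) / (d ^ 2 * γ ^ 2))
    (C : Matrix (Fin N) (Fin N) ℝ) (hC : C = Cbar + ζ • vecMulVec ξ ξ) :
    IsUnit C ∧ ξ ⬝ᵥ C⁻¹ *ᵥ ξ = γ ^ 2 := by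
  have hk : 1 + ζ * (ξ ⬝ᵥ Cbar⁻¹ *ᵥ ξ) = d ^ 2 / γ ^ 2 := by
    rw [← hd2, hζ]
    field_simp
    ring
  have hne : 1 + ζ * (ξ ⬝ᵥ Cbar⁻¹ *ᵥ ξ) ≠ 0 := by
    rw [hk]
    positivity
  rw [hC]
  refine ⟨isUnit_add_smul_vecMulVec hCbar.isUnit ξ ξ ζ hne, ?_⟩
  rw [dotProduct_inv_add_smul_vecMulVec_mulVec hCbar.isUnit ξ ξ ζ hne, hk, ← hd2]
  field_simp
end

section
/- Let $\bar{C}$ be an $N \times N$ real positive definite matrix, let $\xi \in \mathbb{R}^N$ be nonzero, let $d > 0$ satisfy $d^2 = \xi^\mathrm{T} \bar{C}^{-1} \xi$, let $\gamma > 0$, and set $\zeta = (d^2 - \gamma^2)/(d^2 \gamma^2)$. Then the corrected matrix $C = \bar{C} + \zeta\, \xi \xi^\mathrm{T}$ is positive definite. -/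
open Matrix

/-- Cauchy–Schwarz inequality between a positive definite quadratic form and its inverse. -/
theorem Matrix.PosDef.sq_dotProduct_le {n : Type*} [Fintype n] [DecidableEq n]
    {A : Matrix n n ℝ} (hA : A.PosDef) (x y : n → ℝ) :
    (y ⬝ᵥ x) ^ 2 ≤ (x ⬝ᵥ A *ᵥ x) * (y ⬝ᵥ A⁻¹ *ᵥ y) := by
  have hAy : A *ᵥ (A⁻¹ *ᵥ y) = y := by
    rw [mulVec_mulVec, mul_nonsing_inv _ ((isUnit_iff_isUnit_det A).1 hA.isUnit), one_mulVec]
  have hsymm : (A⁻¹ *ᵥ y) ⬝ᵥ A *ᵥ x = y ⬝ᵥ x := by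
    have hT : Aᵀ = A := by simpa [IsHermitian] using hA.isHermitian
    rw [dotProduct_mulVec, ← mulVec_transpose, hT, hAy]
  have hquad (t : ℝ) :
      0 ≤ (y ⬝ᵥ A⁻¹ *ᵥ y) * (t * t) + (-2 * (y ⬝ᵥ x)) * t + x ⬝ᵥ A *ᵥ x := by
    have h := hA.posSemidef.dotProduct_mulVec_nonneg (x - t • (A⁻¹ *ᵥ y))
    simp only [star_trivial, mulVec_sub, mulVec_smul, hAy, sub_dotProduct, dotProduct_sub,
      smul_dotProduct, dotProduct_smul, hsymm, smul_eq_mul] at h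
    rw [dotProduct_comm x y, dotProduct_comm (A⁻¹ *ᵥ y) y] at h
    linarith
  have h := discrim_le_zero hquad
  rw [discrim] at h
  linarith

/-- The margin correction `C = C̄ + ζ ξ ξᵀ` with `ζ = (d² - γ²)/(d² γ²)`, where
`d² = ξᵀ C̄⁻¹ ξ`, yields a positive definite matrix. -/
theorem margin_correction_posDef {N : ℕ}
    (Cbar : Matrix (Fin N) (Fin N) ℝ) (hCbar : Cbar.PosDef)
    (ξ : Fin N → ℝ) (hξ : ξ ≠ 0)
    (d γ : ℝ) (hd : 0 < d) (hγ : 0 < γ)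
    (hd2 : d ^ 2 = ξ ⬝ᵥ Cbar⁻¹ *ᵥ ξ)
    (ζ : ℝ) (hζ : ζ = (d ^ 2 - γ ^ 2) / (d ^ 2 * γ ^ 2))
    (C : Matrix (Fin N) (Fin N) ℝ) (hC : C = Cbar + ζ • vecMulVec ξ ξ) :
    C.PosDef := by
  subst hC
  refine PosDef.of_dotProduct_mulVec_pos
    (hCbar.isHermitian.add ?_) fun x hx => ?_
  · ext i j
    simp [vecMulVec_apply, mul_comm]
  have hform : star x ⬝ᵥ (Cbar + ζ • vecMulVec ξ ξ) *ᵥ x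
      = x ⬝ᵥ Cbar *ᵥ x + ζ * (ξ ⬝ᵥ x) ^ 2 := by
    simp [add_mulVec, smul_mulVec, vecMulVec_mulVec, dotProduct_add, dotProduct_smul,
      dotProduct_comm x ξ, sq]
  have hpos : 0 < x ⬝ᵥ Cbar *ᵥ x := by simpa using hCbar.dotProduct_mulVec_pos hx
  have hcs := hCbar.sq_dotProduct_le x ξ
  rw [← hd2] at hcs
  have hζ' : ζ = 1 / γ ^ 2 - 1 / d ^ 2 := by
    rw [hζ]
    field_simp
  rw [hform, hζ']
  rcases eq_or_ne (ξ ⬝ᵥ x) 0 with hs | hs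
  · simpa [hs] using hpos
  · have hle : (ξ ⬝ᵥ x) ^ 2 / d ^ 2 ≤ x ⬝ᵥ Cbar *ᵥ x := (div_le_iff₀ (by positivity)).2 hcs
    have hlt : 0 < (ξ ⬝ᵥ x) ^ 2 / γ ^ 2 := by positivity
    calc 0 < (ξ ⬝ᵥ x) ^ 2 / γ ^ 2 + (x ⬝ᵥ Cbar *ᵥ x - (ξ ⬝ᵥ x) ^ 2 / d ^ 2) := by linarith
      _ = _ := by ring
end

section
/- Let $\bar{C}$ be an $N \times N$ real positive definite matrix, let $\xi \in \mathbb{R}^N$ be nonzero, let $d > 0$ satisfy $d^2 = \xi^\mathrm{T} \bar{C}^{-1} \xi$, let $\alpha \in (0,1)$, let $\gamma > 0$ satisfy $\Phi_{\mathrm{cdf}}(\gamma) = 1 - \alpha$ where $\Phi_{\mathrm{cdf}}$ is the cumulative distribution function of the standard normal distribution, and set $\zeta = (d^2 - \gamma^2)/(d^2 \gamma^2)$ and $C = \bar{C} + \zeta\, \xi \xi^\mathrm{T}$. Then $C$ is invertible and the marginal probability after correction equals the margin exactly: $\Phi_{\mathrm{cdf}}\bigl(-\sqrt{\xi^\mathrm{T}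 C^{-1} \xi}\bigr) = \alpha$. -/
open Matrix ProbabilityTheory

open MeasureTheory in
theorem cdf_gaussianReal_zero_neg {v : NNReal} (hv : v ≠ 0) (x : ℝ) :
    cdf (gaussianReal 0 v) (-x) = 1 - cdf (gaussianReal 0 v) x := by
  have := nullSingletonClass_gaussianReal (μ := 0) hv
  have hneg : (gaussianReal 0 v).real (Set.Iic (-x)) = (gaussianReal 0 v).real (Set.Ici x) := by
    conv_lhs => rw [← neg_zero, ← gaussianReal_map_neg]
    rw [map_measureReal_apply measurable_neg measurableSet_Iic]
    congr 1
    ext y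
    simp
  rw [cdf_eq_real, cdf_eq_real, hneg, measureReal_congr Ioi_ae_eq_Ici.symm, ← Set.compl_Iic,
    probReal_compl_eq_one_sub measurableSet_Iic]

section RankOneUpdate

variable {n K : Type*} [Fintype n] [Field K]

theorem add_smul_vecMulVec_mulVec (A : Matrix n n K) (u x : n → K) (c : K) :
    (A + c • vecMulVec u u) *ᵥ x = A *ᵥ x + (c * (u ⬝ᵥ x)) • u := by
  rw [add_mulVec, smul_mulVec, vecMulVec_mulVec, op_smul_eq_smul, smul_smul]

variable [DecidableEq n]

theorem isUnit_add_smul_vecMulVec {A : Matrix n n K} (hA : IsUnit A) {u : n → K} {c : K}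
    (h : 1 + c * (u ⬝ᵥ A⁻¹ *ᵥ u) ≠ 0) : IsUnit (A + c • vecMulVec u u) := by
  have hdet := (isUnit_iff_isUnit_det A).1 hA
  rw [← mulVec_injective_iff_isUnit]
  refine (injective_iff_map_eq_zero (mulVecLin (A + c • vecMulVec u u))).2 fun x hx ↦ ?_
  rw [mulVecLin_apply, add_smul_vecMulVec_mulVec] at hx
  have hx' : x + (c * (u ⬝ᵥ x)) • (A⁻¹ *ᵥ u) = 0 := by
    simpa [mulVec_add, mulVec_smul, mulVec_mulVec, nonsing_inv_mul A hdet] using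
      congrArg (A⁻¹ *ᵥ ·) hx
  have hux : u ⬝ᵥ x = 0 := by
    have hdot := congrArg (u ⬝ᵥ ·) hx'
    simp only [dotProduct_add, dotProduct_smul, smul_eq_mul, dotProduct_zero] at hdot
    refine (mul_eq_zero.1 (?_ : (1 + c * (u ⬝ᵥ A⁻¹ *ᵥ u)) * (u ⬝ᵥ x) = 0)).resolve_left h
    linear_combination hdot
  simpa [hux] using hx'

theorem dotProduct_inv_add_smul_vecMulVec_mulVec {A : Matrix n n K} (hA : IsUnit A) {u : n → K}
    {c : K} (h : 1 + c * (u ⬝ᵥ A⁻¹ *ᵥ u) ≠ 0) :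
    u ⬝ᵥ (A + c • vecMulVec u u)⁻¹ *ᵥ u = (u ⬝ᵥ A⁻¹ *ᵥ u) / (1 + c * (u ⬝ᵥ A⁻¹ *ᵥ u)) := by
  have hdet := (isUnit_iff_isUnit_det A).1 hA
  have hdet' := (isUnit_iff_isUnit_det _).1 (isUnit_add_smul_vecMulVec hA h)
  have hmul : (A + c • vecMulVec u u) *ᵥ (A⁻¹ *ᵥ u) = (1 + c * (u ⬝ᵥ A⁻¹ *ᵥ u)) • u := by
    rw [add_smul_vecMulVec_mulVec, mulVec_mulVec, mul_nonsing_inv A hdet, one_mulVec, add_smul,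
      one_smul]
  have hinv := congrArg ((A + c • vecMulVec u u)⁻¹ *ᵥ ·) hmul
  simp only [mulVec_mulVec _ (A + c • vecMulVec u u)⁻¹ (A + c • vecMulVec u u),
    nonsing_inv_mul _ hdet', one_mulVec, mulVec_smul] at hinv
  rw [eq_div_iff h]
  conv_rhs => rw [hinv, dotProduct_smul, smul_eq_mul]
  exact mul_comm _ _

end RankOneUpdate

/-- After the margin correction `C = C̄ + ζ ξ ξᵀ` with `ζ = (d² - γ²)/(d² γ²)`,
the marginal probability `Φcdf(-√(ξᵀ C⁻¹ ξ))` equals the margin `α` exactly. -/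
theorem margin_correction_probability_eq_margin {N : ℕ}
    (Cbar : Matrix (Fin N) (Fin N) ℝ) (hCbar : Cbar.PosDef)
    (ξ : Fin N → ℝ) (hξ : ξ ≠ 0)
    (d : ℝ) (hd : 0 < d) (hd2 : d ^ 2 = ξ ⬝ᵥ Cbar⁻¹ *ᵥ ξ)
    (α : ℝ) (hα : α ∈ Set.Ioo (0 : ℝ) 1)
    (γ : ℝ) (hγ : 0 < γ) (hγα : cdf (gaussianReal 0 1) γ = 1 - α)
    (ζ : ℝ) (hζ : ζ = (d ^ 2 - γ ^ 2) / (d ^ 2 * γ ^ 2))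
    (C : Matrix (Fin N) (Fin N) ℝ) (hC : C = Cbar + ζ • vecMulVec ξ ξ) :
    IsUnit C ∧ cdf (gaussianReal 0 1) (-Real.sqrt (ξ ⬝ᵥ C⁻¹ *ᵥ ξ)) = α := by
  have hfac : 1 + ζ * (ξ ⬝ᵥ Cbar⁻¹ *ᵥ ξ) = d ^ 2 / γ ^ 2 := by
    rw [← hd2, hζ]
    field_simp
    ring
  have hne : 1 + ζ * (ξ ⬝ᵥ Cbar⁻¹ *ᵥ ξ) ≠ 0 := by
    rw [hfac]
    positivity
  subst hC
  refine ⟨isUnit_add_smul_vecMulVec hCbar.isUnit hne, ?_⟩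
  have hquad : d ^ 2 / (d ^ 2 / γ ^ 2) = γ ^ 2 := by field_simp
  rw [dotProduct_inv_add_smul_vecMulVec_mulVec hCbar.isUnit hne, hfac, ← hd2, hquad,
    Real.sqrt_sq hγ.le, cdf_gaussianReal_zero_neg one_ne_zero, hγα, sub_sub_cancel]
end
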